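/- Under the smoothness and convexity assumptions, for every μ with σ_{ψμ} > 0, the gradient of Φ_μ(x) := F(x, y*_μ(x)), given by ∇Φ_μ(x) = ∇_x F(x, y*_μ(x)) − [∇²_{xy} ψ_μ(x, y*_μ(x))] v*_μ(x), satisfies for all x, x' ∈ ℝⁿ: ‖∇Φ_μ(x) − ∇Φ_μ(x')‖ ≤ ((C_{Φ1} ‖v*_μ(x)‖ + C_{Φ2}) / σ_{ψμ}²) ‖x − x'‖, where C_{Φ1} := L_{ψy1}² L_{ψyy2} + L_{ψy1}(L_{ψyy1} + L_{ψxy2}) σ_{ψμ} + L_{ψxy1} σ_{ψμ}² and C_{Φ2} := L_{ψy1}² L_{Fy2} + L_{ψy1}(L_{Fy1} + L_{Fx2}) σ_{ψμ} + L_{Fx1} σ_{ψμ}². -/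

import Mathlib

open Set Filter Asymptotics
open scoped NNReal

noncomputable section

/-- `ℝⁿ` as a Euclidean space. -/
abbrev Eu (n : ℕ) : Type := EuclideanSpace ℝ (Fin n)

variable {n m : ℕ}

/-- Partial gradient with respect to the first (upper-level) variable. -/
def gradx (F : Eu n → Eu m → ℝ) (x : Eu n) (y : Eu m) : Eu n :=
  gradient (fun x' => F x' y) x

/-- Partial gradient with respect to the second (lower-level) variable. -/
def grady (F : Eu n → Eu m → ℝ) (x : Eu n) (y : Eu m) : Eu m :=
  gradient (fun y' => F x y') y

/-- Second-order partial derivative `∇²_{yy}`. -/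
def hessyy (F : Eu n → Eu m → ℝ) (x : Eu n) (y : Eu m) : Eu m →L[ℝ] Eu m :=
  fderiv ℝ (fun y' => grady F x y') y

/-- Mixed second-order partial derivative `∇²_{xy}`, viewed as the linear map
sending a multiplier `v ∈ ℝᵐ` to an element of `ℝⁿ`. -/
def hessxy (F : Eu n → Eu m → ℝ) (x : Eu n) (y : Eu m) : Eu m →L[ℝ] Eu n :=
  ContinuousLinearMap.adjoint (fderiv ℝ (fun x' => grady F x' y) x)

/-- The aggregation function `ψ_μ = μ F + (1-μ) f`. -/
def aggreg (μ : ℝ) (F f : Eu n → Eu m → ℝ) : Eu n → Eu m → ℝ :=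
  fun x y => μ * F x y + (1 - μ) * f x y

/-- The squared KKT residual of the equality-constrained reformulation
`min F(x,y) s.t. ∇_y f(x,y) = 0`. -/
def KKTres (F f : Eu n → Eu m → ℝ) (x : Eu n) (y v : Eu m) : ℝ :=
  ‖gradx F x y - hessxy f x y v‖ ^ 2 + ‖grady F x y - hessyy f x y v‖ ^ 2 +
    ‖grady f x y‖ ^ 2

open Topology

section StrongConvexity

variable {E : Type*} [NormedAddCommGroup E] [InnerProductSpace ℝ E]

theorem StrongConvexOn.inner_gradient_le [CompleteSpace E] {g : E → ℝ} {σ : ℝ}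
    (hg : StrongConvexOn univ σ g)
    {y : E} (hd : DifferentiableAt ℝ g y) (z : E) :
    inner ℝ (gradient g y) (z - y) ≤ g z - g y - σ / 2 * ‖y - z‖ ^ 2 := by
  have h1 := (hd.hasGradientAt.hasFDerivAt.hasLineDerivAt (z - y)).tendsto_slope_zero_right
  have h2 : Tendsto (fun t : ℝ => g z - g y - (1 - t) * (σ / 2 * ‖y - z‖ ^ 2)) (𝓝[>] 0)
      (𝓝 (g z - g y - (1 - 0) * (σ / 2 * ‖y - z‖ ^ 2))) :=
    Tendsto.mono_left (Continuous.tendsto (by fun_prop) 0) nhdsWithin_le_nhds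
  have h3 := le_of_tendsto_of_tendsto h1 h2 ?_
  · simpa using h3
  filter_upwards [Ioo_mem_nhdsGT (zero_lt_one' ℝ)] with t ht
  have h := hg.2 (mem_univ y) (mem_univ z) (sub_nonneg.2 ht.2.le) ht.1.le (by ring)
  have e : (1 - t) • y + t • z = y + t • (z - y) := by module
  rw [e] at h
  simp only [smul_eq_mul] at h ⊢
  rw [inv_mul_le_iff₀ ht.1]
  linarith

theorem StrongConvexOn.le_inner_gradient_sub [CompleteSpace E] {g : E → ℝ} {σ : ℝ}
    (hg : StrongConvexOn univ σ g) (hd : Differentiable ℝ g) (y z : E) :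
    σ * ‖y - z‖ ^ 2 ≤ inner ℝ (gradient g y - gradient g z) (y - z) := by
  have h1 := hg.inner_gradient_le (hd y) z
  have h2 := hg.inner_gradient_le (hd z) y
  rw [norm_sub_rev z y] at h2
  rw [← neg_sub y z, inner_neg_right] at h1
  rw [inner_sub_left]
  linarith

/-- The derivative of a strongly monotone map is coercive. -/
theorem le_inner_of_hasFDerivAt_of_strongly_monotone {g : E → E} {A : E →L[ℝ] E} {y : E} {σ : ℝ}
    (hg : ∀ z, σ * ‖z - y‖ ^ 2 ≤ inner ℝ (g z - g y) (z - y)) (hA : HasFDerivAt g A y) (w : E) :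
    σ * ‖w‖ ^ 2 ≤ inner ℝ (A w) w := by
  have h1 := (hA.hasLineDerivAt w).tendsto_slope_zero_right
  have h2 : Tendsto (fun t : ℝ => inner ℝ (t⁻¹ • (g (y + t • w) - g y)) w) (𝓝[>] 0)
      (𝓝 (inner ℝ (A w) w)) := by
    simpa using h1.inner (tendsto_const_nhds (x := w))
  refine ge_of_tendsto h2 ?_
  filter_upwards [self_mem_nhdsWithin] with t (ht : 0 < t)
  have h := hg (y + t • w)
  rw [add_sub_cancel_left, norm_smul, Real.norm_of_nonneg ht.le, inner_smul_right] at h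
  rw [real_inner_smul_left, le_inv_mul_iff₀ ht]
  have : t * (t * (σ * ‖w‖ ^ 2)) ≤ t * inner ℝ (g (y + t • w) - g y) w := by linarith
  exact le_of_mul_le_mul_left this ht

theorem ContinuousLinearMap.mul_norm_le_of_coercive {A : E →L[ℝ] E} {σ : ℝ}
    (hA : ∀ w, σ * ‖w‖ ^ 2 ≤ inner ℝ (A w) w) (w : E) : σ * ‖w‖ ≤ ‖A w‖ := by
  rcases eq_or_ne w 0 with rfl | hw
  · simp
  have h := (hA w).trans (real_inner_le_norm _ _)
  rw [pow_two, ← mul_assoc] at h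
  exact le_of_mul_le_mul_right h (norm_pos_iff.2 hw)

theorem ContinuousLinearMap.isInvertible_of_coercive [FiniteDimensional ℝ E] {A : E →L[ℝ] E}
    {σ : ℝ} (hσ : 0 < σ) (hA : ∀ w, σ * ‖w‖ ^ 2 ≤ inner ℝ (A w) w) : A.IsInvertible := by
  have hinj : Function.Injective (A : E →ₗ[ℝ] E) := by
    rw [← LinearMap.ker_eq_bot, LinearMap.ker_eq_bot']
    intro w hw
    have h := A.mul_norm_le_of_coercive hA w
    have hw' : A w = 0 := hw
    rw [hw', norm_zero] at h
    exact norm_le_zero_iff.1 (by nlinarith)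
  refine ⟨(LinearEquiv.ofInjectiveEndo (A : E →ₗ[ℝ] E) hinj).toContinuousLinearEquiv, ?_⟩
  ext w
  rfl

end StrongConvexity

/-- Differentiability of a Lipschitz solution branch of `G (x, y x) = 0`. -/
theorem hasFDerivAt_of_implicit {X Y Z : Type*} [NormedAddCommGroup X] [NormedSpace ℝ X]
    [NormedAddCommGroup Y] [NormedSpace ℝ Y] [NormedAddCommGroup Z] [NormedSpace ℝ Z]
    {G : X × Y → Z} {B : X →L[ℝ] Z} {A : Y →L[ℝ] Z} {y : X → Y} {x : X} {K : ℝ≥0}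
    (hy : LipschitzWith K y) (hG0 : ∀ x, G (x, y x) = 0)
    (hG : HasFDerivAt G (B.coprod A) (x, y x)) (hA : A.IsInvertible) :
    HasFDerivAt y (-(A.inverse ∘L B)) x := by
  have hk : Tendsto (fun x' => (x', y x')) (𝓝 x) (𝓝 (x, y x)) :=
    (continuous_id.prodMk hy.continuous).tendsto x
  have hO : (fun x' => (x', y x') - (x, y x)) =O[nhds x] fun x' => x' - x := by
    refine IsBigO.of_bound (max 1 K) (Eventually.of_forall fun x' => ?_)
    rw [Prod.mk_sub_mk, Prod.norm_mk]
    have h := hy.norm_sub_le x' x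
    refine max_le ?_ (h.trans ?_)
    · exact le_mul_of_one_le_left (norm_nonneg _) (le_max_left _ _)
    · exact mul_le_mul_of_nonneg_right (le_max_right _ _) (norm_nonneg _)
  have h1 := (hG.isLittleO.comp_tendsto hk).trans_isBigO hO
  have h2 := ((-A.inverse).isBigO_comp _ (𝓝 x)).trans_isLittleO h1
  refine HasFDerivAt.of_isLittleO (h2.congr_left fun x' => ?_)
  simp only [Function.comp_apply, hG0, ContinuousLinearMap.coprod_apply,
    sub_self, zero_sub, neg_apply, map_neg, map_add,
    hA.inverse_apply_self, ContinuousLinearMap.comp_apply, map_sub]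
  abel

theorem DifferentiableAt.hasFDerivAt_coprod {X Y Z : Type*} [NormedAddCommGroup X]
    [NormedSpace ℝ X] [NormedAddCommGroup Y] [NormedSpace ℝ Y] [NormedAddCommGroup Z]
    [NormedSpace ℝ Z] {G : X × Y → Z} {B : X →L[ℝ] Z} {A : Y →L[ℝ] Z} {x : X} {y : Y}
    (hG : DifferentiableAt ℝ G (x, y)) (hB : HasFDerivAt (fun x' => G (x', y)) B x)
    (hA : HasFDerivAt (fun y' => G (x, y')) A y) : HasFDerivAt G (B.coprod A) (x, y) := by
  have h := hG.hasFDerivAt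
  have hx := hB.unique
    (HasFDerivAt.comp (f := fun x' => (x', y)) x h (hasFDerivAt_prodMk_left x y))
  have hy := hA.unique
    (HasFDerivAt.comp (f := fun y' => (x, y')) y h (hasFDerivAt_prodMk_right x y))
  rwa [hx, hy, ContinuousLinearMap.coprod_comp_inl_inr]

section PartialGradients

variable {F f : Eu n → Eu m → ℝ}

theorem contDiff_grady (hF : ContDiff ℝ 2 (Function.uncurry F)) :
    ContDiff ℝ 1 (Function.uncurry (grady F)) := by
  have h : ContDiff ℝ 1 fun p : Eu n × Eu m => fderiv ℝ (F p.1) p.2 := by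
    refine ContDiff.fderiv (m := 2) (n := 1) (f := fun p : Eu n × Eu m => F p.1) ?_ contDiff_snd
      one_add_one_eq_two.le
    exact hF.comp (contDiff_fst.fst.prodMk contDiff_snd)
  exact (InnerProductSpace.toDual ℝ (Eu m)).symm.toContinuousLinearEquiv.contDiff.comp h

theorem contDiff_right (hF : ContDiff ℝ 2 (Function.uncurry F)) (x : Eu n) :
    ContDiff ℝ 2 (F x) :=
  hF.comp (contDiff_const.prodMk contDiff_id)

theorem differentiable_right (hF : ContDiff ℝ 2 (Function.uncurry F)) (x : Eu n) :
    Differentiable ℝ (F x) :=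
  (contDiff_right hF x).differentiable (by norm_num)

theorem differentiable_left (hF : ContDiff ℝ 2 (Function.uncurry F)) (y : Eu m) :
    Differentiable ℝ fun x => F x y :=
  (hF.comp (contDiff_id.prodMk contDiff_const)).differentiable (by norm_num)

theorem hasFDerivAt_uncurry_gradx_grady (hF : ContDiff ℝ 2 (Function.uncurry F))
    (x : Eu n) (y : Eu m) :
    HasFDerivAt (Function.uncurry F)
      ((innerSL ℝ (gradx F x y)).coprod (innerSL ℝ (grady F x y))) (x, y) := by
  refine DifferentiableAt.hasFDerivAt_coprod (hF.differentiable (by norm_num) (x, y)) ?_ ?_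
  · exact (differentiable_left hF y x).hasGradientAt.hasFDerivAt
  · exact (differentiable_right hF x y).hasGradientAt.hasFDerivAt

theorem hasFDerivAt_grady_right (hF : ContDiff ℝ 2 (Function.uncurry F))
    (x : Eu n) (y : Eu m) : HasFDerivAt (grady F x) (hessyy F x y) y :=
  (((contDiff_grady hF).comp (contDiff_const.prodMk contDiff_id)).differentiable
    one_ne_zero y).hasFDerivAt

theorem hasFDerivAt_grady_left (hF : ContDiff ℝ 2 (Function.uncurry F))
    (x : Eu n) (y : Eu m) :
    HasFDerivAt (fun x' => grady F x' y) (ContinuousLinearMap.adjoint (hessxy F x y)) x := by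
  rw [hessxy, ContinuousLinearMap.adjoint_adjoint]
  exact (((contDiff_grady hF).comp (contDiff_id.prodMk contDiff_const)).differentiable
    one_ne_zero x).hasFDerivAt

theorem hasFDerivAt_uncurry_grady (hF : ContDiff ℝ 2 (Function.uncurry F))
    (x : Eu n) (y : Eu m) :
    HasFDerivAt (Function.uncurry (grady F))
      ((ContinuousLinearMap.adjoint (hessxy F x y)).coprod (hessyy F x y)) (x, y) :=
  DifferentiableAt.hasFDerivAt_coprod ((contDiff_grady hF).differentiable one_ne_zero (x, y))
    (hasFDerivAt_grady_left hF x y) (hasFDerivAt_grady_right hF x y)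

theorem hessyy_symm (hF : ContDiff ℝ 2 (Function.uncurry F)) (x : Eu n) (y u w : Eu m) :
    inner ℝ (hessyy F x y u) w = inner ℝ u (hessyy F x y w) := by
  have hsymm : IsSymmSndFDerivAt ℝ (F x) y :=
    (contDiff_right hF x).contDiffAt.isSymmSndFDerivAt (by simp)
  have key : ∀ a b, inner ℝ (hessyy F x y a) b = fderiv ℝ (fderiv ℝ (F x)) y a b := by
    intro a b
    have h := (InnerProductSpace.toDual ℝ (Eu m)).toContinuousLinearEquiv.hasFDerivAt.comp y
      (hasFDerivAt_grady_right hF x y)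
    have e : fderiv ℝ (F x) = fun y' =>
        (InnerProductSpace.toDual ℝ (Eu m)).toContinuousLinearEquiv (grady F x y') := by
      ext1 y'
      simp [grady, gradient]
    rw [e]
    exact (congrArg (fun L => L a b) h.fderiv).symm
  rw [key, hsymm.eq, ← key, real_inner_comm]

theorem norm_hessxy_le {L : ℝ} (hL0 : 0 ≤ L) {x : Eu n} {y : Eu m}
    (hL : ∀ x', ‖grady F x' y - grady F x y‖ ≤ L * ‖x' - x‖) : ‖hessxy F x y‖ ≤ L := by
  rw [hessxy, LinearIsometryEquiv.norm_map]
  exact norm_fderiv_le_of_lip' ℝ hL0 (Eventually.of_forall hL)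

end PartialGradients

section Aggregate

variable {F f : Eu n → Eu m → ℝ} (μ : ℝ)

theorem contDiff_aggreg (hF : ContDiff ℝ 2 (Function.uncurry F))
    (hf : ContDiff ℝ 2 (Function.uncurry f)) :
    ContDiff ℝ 2 (Function.uncurry (aggreg μ F f)) :=
  (contDiff_const.mul hF).add (contDiff_const.mul hf)

theorem grady_aggreg (hF : ContDiff ℝ 2 (Function.uncurry F))
    (hf : ContDiff ℝ 2 (Function.uncurry f)) (x : Eu n) (y : Eu m) :
    grady (aggreg μ F f) x y = μ • grady F x y + (1 - μ) • grady f x y := by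
  have h := ((differentiable_right hF x y).hasFDerivAt.const_mul μ).add
    ((differentiable_right hf x y).hasFDerivAt.const_mul (1 - μ))
  have e : fderiv ℝ (aggreg μ F f x) y = _ := h.fderiv
  change (InnerProductSpace.toDual ℝ (Eu m)).symm (fderiv ℝ (aggreg μ F f x) y) = _
  rw [e]
  simp [grady, gradient]

theorem hessyy_aggreg (hF : ContDiff ℝ 2 (Function.uncurry F))
    (hf : ContDiff ℝ 2 (Function.uncurry f)) (x : Eu n) (y : Eu m) :
    hessyy (aggreg μ F f) x y = μ • hessyy F x y + (1 - μ) • hessyy f x y := by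
  have h := ((hasFDerivAt_grady_right hF x y).const_smul μ).add
    ((hasFDerivAt_grady_right hf x y).const_smul (1 - μ))
  rw [hessyy, funext (grady_aggreg μ hF hf x)]
  exact h.fderiv

theorem hessxy_aggreg (hF : ContDiff ℝ 2 (Function.uncurry F))
    (hf : ContDiff ℝ 2 (Function.uncurry f)) (x : Eu n) (y : Eu m) :
    hessxy (aggreg μ F f) x y = μ • hessxy F x y + (1 - μ) • hessxy f x y := by
  have h := ((hasFDerivAt_grady_left hF x y).const_smul μ).add
    ((hasFDerivAt_grady_left hf x y).const_smul (1 - μ))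
  rw [hessxy, funext fun x' => grady_aggreg μ hF hf x' y]
  refine (congrArg ContinuousLinearMap.adjoint h.fderiv).trans ?_
  simp

end Aggregate

theorem LipschitzWith.norm_smul_add_smul_sub_le {X V : Type*} [SeminormedAddCommGroup X]
    [SeminormedAddCommGroup V] [NormedSpace ℝ V] {g h : X → V} {K L : ℝ≥0}
    (hg : LipschitzWith K g) (hh : LipschitzWith L h) {a b : ℝ} (ha : 0 ≤ a) (hb : 0 ≤ b)
    (x x' : X) :
    ‖(a • g x + b • h x) - (a • g x' + b • h x')‖ ≤ (a * K + b * L) * ‖x - x'‖ := by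
  have e : (a • g x + b • h x) - (a • g x' + b • h x') =
      a • (g x - g x') + b • (h x - h x') := by module
  rw [e]
  refine (norm_add_le _ _).trans ?_
  rw [norm_smul, norm_smul, Real.norm_of_nonneg ha, Real.norm_of_nonneg hb, add_mul,
    mul_assoc, mul_assoc]
  gcongr
  · exact hg.norm_sub_le x x'
  · exact hh.norm_sub_le x x'

/-- The gradient of `x ↦ F x (y x)` along a branch `y` of critical points of `ψ x`. -/
theorem gradient_comp_critical_branch {F ψ : Eu n → Eu m → ℝ}
    (hF : ContDiff ℝ 2 (Function.uncurry F)) (hψ : ContDiff ℝ 2 (Function.uncurry ψ))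
    {y : Eu n → Eu m} {K : ℝ≥0} (hy : LipschitzWith K y) (hG0 : ∀ x, grady ψ x (y x) = 0)
    {x : Eu n} (hA : (hessyy ψ x (y x)).IsInvertible) :
    gradient (fun x' => F x' (y x')) x = gradx F x (y x) -
      hessxy ψ x (y x) ((hessyy ψ x (y x)).inverse (grady F x (y x))) := by
  have hy' := hasFDerivAt_of_implicit hy hG0 (hasFDerivAt_uncurry_grady hψ x (y x)) hA
  have hΦ := HasFDerivAt.comp (f := fun x' => (x', y x')) x
    (hasFDerivAt_uncurry_gradx_grady hF x (y x)) ((hasFDerivAt_id x).prodMk hy')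
  refine HasGradientAt.gradient (hasGradientAt_iff_hasFDerivAt.2 (hΦ.congr_fderiv ?_))
  ext h
  have key : ∀ b, inner ℝ (grady F x (y x)) ((hessyy ψ x (y x)).inverse b) =
      inner ℝ ((hessyy ψ x (y x)).inverse (grady F x (y x))) b := by
    intro b
    have h := hessyy_symm hψ x (y x) ((hessyy ψ x (y x)).inverse (grady F x (y x)))
      ((hessyy ψ x (y x)).inverse b)
    rwa [hA.self_apply_inverse, hA.self_apply_inverse] at h
  simp [key, ContinuousLinearMap.adjoint_inner_right, sub_eq_add_neg]

/-- Stability of the solution of `A v = g` for an operator bounded below, and of its image under a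
linear map. -/
theorem norm_apply_sub_apply_le {V W : Type*} [NormedAddCommGroup V] [NormedSpace ℝ V]
    [NormedAddCommGroup W] [NormedSpace ℝ W] {A A' : V →L[ℝ] V} {H H' : V →L[ℝ] W} {v v' : V}
    {σ a b c l : ℝ} (hσ : 0 < σ) (hA' : ∀ w, σ * ‖w‖ ≤ ‖A' w‖) (ha : ‖A - A'‖ ≤ a)
    (hb : ‖A v - A' v'‖ ≤ b) (hc : ‖H - H'‖ ≤ c) (hl : ‖H'‖ ≤ l) :
    ‖H v - H' v'‖ ≤ c * ‖v‖ + l * ((a * ‖v‖ + b) / σ) := by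
  have hv : ‖v - v'‖ ≤ (a * ‖v‖ + b) / σ := by
    rw [le_div_iff₀' hσ]
    refine (hA' _).trans ?_
    have e : A' (v - v') = (A v - A' v') - (A - A') v := by
      simp only [map_sub, sub_apply]
      abel
    rw [e, add_comm]
    exact (norm_sub_le _ _).trans (add_le_add hb ((A - A').le_of_opNorm_le ha v))
  have e : H v - H' v' = (H - H') v + H' (v - v') := by
    simp only [map_sub, sub_apply]
    abel
  rw [e]
  refine (norm_add_le _ _).trans (add_le_add ((H - H').le_of_opNorm_le hc v) ?_)
  exact (H'.le_of_opNorm_le hl _).trans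
    (mul_le_mul_of_nonneg_left hv ((norm_nonneg _).trans hl))

theorem norm_uncurry_sub_le {X Y V : Type*} [SeminormedAddCommGroup X]
    [SeminormedAddCommGroup Y] [SeminormedAddCommGroup V] {g : X → Y → V} {K L D : ℝ}
    (hL : 0 ≤ L) (hx : ∀ y x x', ‖g x y - g x' y‖ ≤ K * ‖x - x'‖)
    (hy : ∀ x y y', ‖g x y - g x y'‖ ≤ L * ‖y - y'‖) {x x' : X} {y y' : Y}
    (hD : ‖y - y'‖ ≤ D * ‖x - x'‖) :
    ‖g x y - g x' y'‖ ≤ (K + L * D) * ‖x - x'‖ := by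
  calc ‖g x y - g x' y'‖ = ‖(g x y - g x' y) + (g x' y - g x' y')‖ := by
        congr 1; abel
    _ ≤ K * ‖x - x'‖ + L * (D * ‖x - x'‖) :=
        (norm_add_le _ _).trans
          (add_le_add (hx _ _ _) ((hy _ _ _).trans (mul_le_mul_of_nonneg_left hD hL)))
    _ = (K + L * D) * ‖x - x'‖ := by ring

/-- Lemma A.2: formula and Lipschitz-type smoothness of `∇Φ_μ`,
where `Φ_μ(x) = F(x, y*_μ(x))`. -/
theorem hyperobjective_gradient_lipschitz {n m : ℕ}
    (F f : Eu n → Eu m → ℝ)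
    (hF : ContDiff ℝ 2 (Function.uncurry F))
    (hf : ContDiff ℝ 2 (Function.uncurry f))
    (LFx1 LFx2 LFy1 LFy2 Lfy1 Lfy2 LFxy1 LFxy2 Lfxy1 Lfxy2 LFyy1 LFyy2 Lfyy1 Lfyy2 : ℝ≥0)
    (hLFx1 : ∀ y, LipschitzWith LFx1 fun x => gradx F x y)
    (hLFx2 : ∀ x, LipschitzWith LFx2 fun y => gradx F x y)
    (hLFy1 : ∀ y, LipschitzWith LFy1 fun x => grady F x y)
    (hLFy2 : ∀ x, LipschitzWith LFy2 fun y => grady F x y)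
    (hLfy1 : ∀ y, LipschitzWith Lfy1 fun x => grady f x y)
    (hLfy2 : ∀ x, LipschitzWith Lfy2 fun y => grady f x y)
    (hLFxy1 : ∀ y, LipschitzWith LFxy1 fun x => hessxy F x y)
    (hLFxy2 : ∀ x, LipschitzWith LFxy2 fun y => hessxy F x y)
    (hLfxy1 : ∀ y, LipschitzWith Lfxy1 fun x => hessxy f x y)
    (hLfxy2 : ∀ x, LipschitzWith Lfxy2 fun y => hessxy f x y)
    (hLFyy1 : ∀ y, LipschitzWith LFyy1 fun x => hessyy F x y)
    (hLFyy2 : ∀ x, LipschitzWith LFyy2 fun y => hessyy F x y)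
    (hLfyy1 : ∀ y, LipschitzWith Lfyy1 fun x => hessyy f x y)
    (hLfyy2 : ∀ x, LipschitzWith Lfyy2 fun y => hessyy f x y)
    (σF σf : ℝ) (hσF : 0 < σF) (hσf : 0 ≤ σf)
    (hFsc : ∀ x, StrongConvexOn univ σF (F x))
    (hfsc : ∀ x, StrongConvexOn univ σf (f x))
    (μ : ℝ) (hμ : μ ∈ Icc (0 : ℝ) 1)
    (σψ : ℝ) (hσψ : σψ = μ * σF + (1 - μ) * σf) (hσψpos : 0 < σψ)
    (ystar : Eu n → Eu m)
    (hmin : ∀ x y, aggreg μ F f x (ystar x) ≤ aggreg μ F f x y)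
    (vstar : Eu n → Eu m)
    (hvstar : ∀ x, vstar x =
      (hessyy (aggreg μ F f) x (ystar x)).inverse (grady F x (ystar x)))
    (Lψy1 Lψxy1 Lψxy2 Lψyy1 Lψyy2 CΦ1 CΦ2 : ℝ)
    (hLψy1 : Lψy1 = μ * LFy1 + (1 - μ) * Lfy1)
    (hLψxy1 : Lψxy1 = μ * LFxy1 + (1 - μ) * Lfxy1)
    (hLψxy2 : Lψxy2 = μ * LFxy2 + (1 - μ) * Lfxy2)
    (hLψyy1 : Lψyy1 = μ * LFyy1 + (1 - μ) * Lfyy1)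
    (hLψyy2 : Lψyy2 = μ * LFyy2 + (1 - μ) * Lfyy2)
    (hCΦ1 : CΦ1 = Lψy1 ^ 2 * Lψyy2 + Lψy1 * (Lψyy1 + Lψxy2) * σψ + Lψxy1 * σψ ^ 2)
    (hCΦ2 : CΦ2 = Lψy1 ^ 2 * LFy2 + Lψy1 * (LFy1 + LFx2) * σψ + LFx1 * σψ ^ 2) :
    (∀ x, gradient (fun x' => F x' (ystar x')) x =
      gradx F x (ystar x) - hessxy (aggreg μ F f) x (ystar x) (vstar x)) ∧
    ∀ x x',
      ‖gradient (fun x' => F x' (ystar x')) x -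
          gradient (fun x' => F x' (ystar x')) x'‖ ≤
        ((CΦ1 * ‖vstar x‖ + CΦ2) / σψ ^ 2) * ‖x - x'‖ := by
  obtain ⟨hμ0, hμ1⟩ := hμ
  have hν0 : 0 ≤ 1 - μ := sub_nonneg.2 hμ1
  have hψ := contDiff_aggreg μ hF hf
  have hmono : ∀ x y z, σψ * ‖y - z‖ ^ 2 ≤
      inner ℝ (grady (aggreg μ F f) x y - grady (aggreg μ F f) x z) (y - z) := by
    intro x y z
    have h1 := (hFsc x).le_inner_gradient_sub (differentiable_right hF x) y z
    have h2 := (hfsc x).le_inner_gradient_sub (differentiable_right hf x) y z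
    have e : grady (aggreg μ F f) x y - grady (aggreg μ F f) x z =
        μ • (gradient (F x) y - gradient (F x) z) +
          (1 - μ) • (gradient (f x) y - gradient (f x) z) := by
      rw [grady_aggreg μ hF hf, grady_aggreg μ hF hf]
      simp only [grady]
      module
    rw [e, inner_add_left, real_inner_smul_left, real_inner_smul_left, hσψ]
    have h3 := mul_le_mul_of_nonneg_left h1 hμ0
    have h4 := mul_le_mul_of_nonneg_left h2 hν0
    linarith
  have hcoer : ∀ x y w, σψ * ‖w‖ ^ 2 ≤ inner ℝ (hessyy (aggreg μ F f) x y w) w := fun x y w =>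
    le_inner_of_hasFDerivAt_of_strongly_monotone (fun z => hmono x z y)
      (hasFDerivAt_grady_right hψ x y) w
  have hinv : ∀ x y, (hessyy (aggreg μ F f) x y).IsInvertible := fun x y =>
    ContinuousLinearMap.isInvertible_of_coercive hσψpos (hcoer x y)
  have hGx : ∀ y x x', ‖grady (aggreg μ F f) x y - grady (aggreg μ F f) x' y‖ ≤
      Lψy1 * ‖x - x'‖ := by
    intro y x x'
    rw [grady_aggreg μ hF hf, grady_aggreg μ hF hf, hLψy1]
    exact (hLFy1 y).norm_smul_add_smul_sub_le (hLfy1 y) hμ0 hν0 x x'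
  have hHx : ∀ y x x', ‖hessxy (aggreg μ F f) x y - hessxy (aggreg μ F f) x' y‖ ≤
      Lψxy1 * ‖x - x'‖ := by
    intro y x x'
    rw [hessxy_aggreg μ hF hf, hessxy_aggreg μ hF hf, hLψxy1]
    exact (hLFxy1 y).norm_smul_add_smul_sub_le (hLfxy1 y) hμ0 hν0 x x'
  have hHy : ∀ x y y', ‖hessxy (aggreg μ F f) x y - hessxy (aggreg μ F f) x y'‖ ≤
      Lψxy2 * ‖y - y'‖ := by
    intro x y y'
    rw [hessxy_aggreg μ hF hf, hessxy_aggreg μ hF hf, hLψxy2]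
    exact (hLFxy2 x).norm_smul_add_smul_sub_le (hLfxy2 x) hμ0 hν0 y y'
  have hAx : ∀ y x x', ‖hessyy (aggreg μ F f) x y - hessyy (aggreg μ F f) x' y‖ ≤
      Lψyy1 * ‖x - x'‖ := by
    intro y x x'
    rw [hessyy_aggreg μ hF hf, hessyy_aggreg μ hF hf, hLψyy1]
    exact (hLFyy1 y).norm_smul_add_smul_sub_le (hLfyy1 y) hμ0 hν0 x x'
  have hAy : ∀ x y y', ‖hessyy (aggreg μ F f) x y - hessyy (aggreg μ F f) x y'‖ ≤
      Lψyy2 * ‖y - y'‖ := by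
    intro x y y'
    rw [hessyy_aggreg μ hF hf, hessyy_aggreg μ hF hf, hLψyy2]
    exact (hLFyy2 x).norm_smul_add_smul_sub_le (hLfyy2 x) hμ0 hν0 y y'
  have hLψy1_nonneg : 0 ≤ Lψy1 := by rw [hLψy1]; positivity
  have hLψxy2_nonneg : 0 ≤ Lψxy2 := by rw [hLψxy2]; positivity
  have hLψyy2_nonneg : 0 ≤ Lψyy2 := by rw [hLψyy2]; positivity
  have hG0 : ∀ x, grady (aggreg μ F f) x (ystar x) = 0 := by
    intro x
    have h : IsLocalMin (aggreg μ F f x) (ystar x) := Eventually.of_forall (hmin x)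
    simp [grady, gradient, h.fderiv_eq_zero]
  have hys : ∀ x x', ‖ystar x - ystar x'‖ ≤ Lψy1 / σψ * ‖x - x'‖ := by
    intro x x'
    have h := (hmono x (ystar x) (ystar x')).trans (real_inner_le_norm _ _)
    rw [hG0 x, ← hG0 x', pow_two, ← mul_assoc] at h
    rw [div_mul_eq_mul_div, le_div_iff₀' hσψpos]
    rcases (norm_nonneg (ystar x - ystar x')).eq_or_lt with h0 | hpos
    · rw [← h0, mul_zero]
      positivity
    · refine (le_of_mul_le_mul_right h hpos).trans ?_
      rw [norm_sub_rev x x']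
      exact hGx _ _ _
  have hysLip : LipschitzWith (Lψy1 / σψ).toNNReal ystar :=
    LipschitzWith.of_dist_le' fun x x' => by simpa only [dist_eq_norm] using hys x x'
  have hgrad : ∀ x, gradient (fun x' => F x' (ystar x')) x =
      gradx F x (ystar x) - hessxy (aggreg μ F f) x (ystar x) (vstar x) := by
    intro x
    rw [hvstar]
    exact gradient_comp_critical_branch hF hψ hysLip hG0 (hinv x _)
  refine ⟨hgrad, fun x x' => ?_⟩
  have hAv : ∀ x, hessyy (aggreg μ F f) x (ystar x) (vstar x) = grady F x (ystar x) := by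
    intro x
    rw [hvstar, (hinv x _).self_apply_inverse]
  have hx := norm_uncurry_sub_le (g := gradx F) LFx2.2 (fun y => (hLFx1 y).norm_sub_le)
    (fun x => (hLFx2 x).norm_sub_le) (hys x x')
  have hy := norm_uncurry_sub_le (g := grady F) LFy2.2 (fun y => (hLFy1 y).norm_sub_le)
    (fun x => (hLFy2 x).norm_sub_le) (hys x x')
  rw [← hAv x, ← hAv x'] at hy
  have hv := norm_apply_sub_apply_le hσψpos
    (ContinuousLinearMap.mul_norm_le_of_coercive (hcoer x' (ystar x')))
    (norm_uncurry_sub_le hLψyy2_nonneg hAx hAy (hys x x')) hy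
    (norm_uncurry_sub_le hLψxy2_nonneg hHx hHy (hys x x'))
    (norm_hessxy_le hLψy1_nonneg fun x₁ => hGx (ystar x') x₁ x')
  rw [hgrad, hgrad, sub_sub_sub_comm]
  refine (norm_sub_le _ _).trans ((add_le_add hx hv).trans_eq ?_)
  rw [hCΦ1, hCΦ2]
  simp only [NNReal.val_eq_coe]
  field_simp
  ring
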